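/- For real parameters c1, c2, c3, an integer N ≥ 1, and integers n, x with 0 ≤ n ≤ N and 0 ≤ x ≤ N, the renormalized Racah polynomials satisfy the contiguity difference equation μ⁻_n(c_{23}; N) · p_n(x; c1,c2,c3; N) = B⁻(x; c1,c2; N) · p_n(x+1; c1,c2,c3; N−1) − S⁻(x; c1,c2; N) · p_n(x; c1,c2,c3; N−1) + D⁻(x; c1,c2; N) · p_n(x−1; c1,c2,c3; N−1). -/

import Mathlib

open Finset

noncomputable section

/-- Pochhammer symbol `(a)_k = a (a+1) ⋯ (a+k-1)`. -/
def poch (a : ℝ) (k : ℕ) : ℝ := ∏ i ∈ Finset.range k, (a + i)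

/-- A real number is *generic* if it is not an integer. -/
def Generic (r : ℝ) : Prop := ∀ m : ℤ, r ≠ (m : ℝ)

/-- Genericity for three parameters: none of the parameters, nor any sum of two or three
of them, is an integer; this guarantees that no denominator vanishes. -/
def Generic3 (c1 c2 c3 : ℝ) : Prop :=
  Generic c1 ∧ Generic c2 ∧ Generic c3 ∧
  Generic (c1+c2) ∧ Generic (c1+c3) ∧ Generic (c2+c3) ∧
  Generic (c1+c2+c3)

/-- Genericity for four parameters: none of the parameters, nor any sum of two, three or
four of them, is an integer; this guarantees that no denominator vanishes. -/
def Generic4 (c1 c2 c3 c4 : ℝ) : Prop :=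
  Generic c1 ∧ Generic c2 ∧ Generic c3 ∧ Generic c4 ∧
  Generic (c1+c2) ∧ Generic (c1+c3) ∧ Generic (c1+c4) ∧
  Generic (c2+c3) ∧ Generic (c2+c4) ∧ Generic (c3+c4) ∧
  Generic (c1+c2+c3) ∧ Generic (c1+c2+c4) ∧ Generic (c1+c3+c4) ∧ Generic (c2+c3+c4) ∧
  Generic (c1+c2+c3+c4)

/-- Normalization `Ω(n; c1,c2,c3; M)`. -/
def Om (n : ℤ) (c1 c2 c3 : ℝ) (M : ℤ) : ℝ :=
  (M.toNat.choose n.toNat : ℝ) * (2*(n:ℝ) + c2 + c3 + 1) *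
    poch (c2+1) n.toNat * poch ((M:ℝ)+2+c1+c2+c3) n.toNat * poch (c1+1) (M-n).toNat /
    (poch (c3+1) n.toNat * poch (c2+c3+(n:ℝ)+1) (M.toNat+1))

/-- The renormalized Racah polynomial `p_n(x; c1,c2,c3; M)`, with the convention that it
vanishes unless `0 ≤ n ≤ M`. -/
def racah (n : ℤ) (x : ℝ) (c1 c2 c3 : ℝ) (M : ℤ) : ℝ :=
  if 0 ≤ n ∧ n ≤ M then
    Om n c1 c2 c3 M *
      ∑ k ∈ Finset.range (n.toNat + 1),
        (poch (-(n:ℝ)) k * poch ((n:ℝ)+c2+c3+1) k * poch (-x) k * poch (x+c1+c2+1) k) /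
        (poch (c2+1) k * poch ((M:ℝ)+2+c1+c2+c3) k * poch (-(M:ℝ)) k * (Nat.factorial k : ℝ))
  else 0

/-- Weight `Λ(x; c1,c2; M)`. -/
def Lam (x : ℤ) (c1 c2 : ℝ) (M : ℤ) : ℝ :=
  (-1:ℝ)^x.toNat * (M.toNat.choose x.toNat : ℝ) * (2*(x:ℝ)+c1+c2+1) * poch (c2+1) x.toNat /
    (poch (c1+1) x.toNat * poch ((x:ℝ)+c1+c2+1) (M.toNat+1))

/-- `λ(x; c) = x(x+c+1)`. -/
def lam (x c : ℝ) : ℝ := x*(x+c+1)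

/-- `μ_n(c) = n(n+c+1)`. -/
def mu (n c : ℝ) : ℝ := n*(n+c+1)

/-- Recurrence coefficient `A_n(c1,c2,c3; M)`. -/
def coefA (n c1 c2 c3 M : ℝ) : ℝ :=
  (n-M)*(n+c1+c2+c3+M+2)*(n+c2+1)*(n+c2+c3+1)/((2*n+c2+c3+1)*(2*n+c2+c3+2))

/-- Recurrence coefficient `C_n(c1,c2,c3; M)`. -/
def coefC (n c1 c2 c3 M : ℝ) : ℝ :=
  n*(n-c1-M-1)*(n+c2+c3+M+1)*(n+c3)/((2*n+c2+c3)*(2*n+c2+c3+1))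

/-- `Σ_n = A_n + C_n`. -/
def coefSig (n c1 c2 c3 M : ℝ) : ℝ := coefA n c1 c2 c3 M + coefC n c1 c2 c3 M

/-- Difference coefficient `B(x; c1,c2,c3; M)`. -/
def coefB (x c1 c2 c3 M : ℝ) : ℝ :=
  (x-M)*(x+c2+1)*(x+c1+c2+c3+M+2)*(x+c1+c2+1)/((2*x+c1+c2+1)*(2*x+c1+c2+2))

/-- Difference coefficient `D(x; c1,c2,c3; M)`. -/
def coefD (x c1 c2 c3 M : ℝ) : ℝ :=
  x*(x+c1)*(x-c3-M-1)*(x+c1+c2+M+1)/((2*x+c1+c2)*(2*x+c1+c2+1))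

/-- `S = B + D`. -/
def coefS (x c1 c2 c3 M : ℝ) : ℝ := coefB x c1 c2 c3 M + coefD x c1 c2 c3 M

/-- `F(x; c1,c2)`. -/
def Ffun (x c1 c2 : ℝ) : ℝ :=
  (x+c2+1)*(x+c1+c2+1)/((2*x+c1+c2+1)*(2*x+c1+c2+2))

/-- `λ⁺(x; c12; M) = (x+c12+M+2)(x−M−1)`. -/
def lamP (x c12 M : ℝ) : ℝ := (x+c12+M+2)*(x-M-1)

/-- `A⁺_n(c2,c3; M)`. -/
def Ap (n c2 c3 M : ℝ) : ℝ := -(n-M-1)*(n-M)*Ffun n c3 c2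

/-- `C⁺_n(c2,c3; M) = A⁺_{−n−c23−1}(c2,c3; M)`. -/
def Cp (n c2 c3 M : ℝ) : ℝ := Ap (-n-c2-c3-1) c2 c3 M

/-- `Σ⁺_n = A⁺_n + C⁺_n + (M+1)(M+1+c3)`. -/
def Sp (n c2 c3 M : ℝ) : ℝ := Ap n c2 c3 M + Cp n c2 c3 M + (M+1)*(M+1+c3)

/-- `λ⁻(x; c123, c3; M) = (x+c123+M+1)(x−M−c3)`. -/
def lamM (x c123 c3 M : ℝ) : ℝ := (x+c123+M+1)*(x-M-c3)

/-- `A⁻_n(c1,c2,c3; M)`. -/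
def Am (n c1 c2 c3 M : ℝ) : ℝ := -(n+c1+c2+c3+M+1)*(n+c1+c2+c3+M+2)*Ffun n c3 c2

/-- `C⁻_n(c1,c2,c3; M) = A⁻_{−n−c23−1}(c1,c2,c3; M)`. -/
def Cm (n c1 c2 c3 M : ℝ) : ℝ := Am (-n-c2-c3-1) c1 c2 c3 M

/-- `Σ⁻_n = A⁻_n + C⁻_n + (M+c12+1)(M+c123+1)`. -/
def Sm (n c1 c2 c3 M : ℝ) : ℝ :=
  Am n c1 c2 c3 M + Cm n c1 c2 c3 M + (M+c1+c2+1)*(M+c1+c2+c3+1)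

/-- `μ⁺_n(c123, c1; M) = (n+c123+M+2)(n−M−1−c1)`. -/
def muP (n c123 c1 M : ℝ) : ℝ := (n+c123+M+2)*(n-M-1-c1)

/-- `B⁺(x; c1,c2,c3; M)`. -/
def Bp (x c1 c2 c3 M : ℝ) : ℝ := -(x+c1+c2+c3+M+2)*(x+c1+c2+c3+M+3)*Ffun x c1 c2

/-- `D⁺(x; c1,c2,c3; M) = B⁺(−x−c12−1; c1,c2,c3; M)`. -/
def Dp (x c1 c2 c3 M : ℝ) : ℝ := Bp (-x-c1-c2-1) c1 c2 c3 M

/-- `S⁺ = B⁺ + D⁺ + (c23+M+2)(c123+M+2)`. -/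
def SpD (x c1 c2 c3 M : ℝ) : ℝ :=
  Bp x c1 c2 c3 M + Dp x c1 c2 c3 M + (c2+c3+M+2)*(c1+c2+c3+M+2)

/-- `μ⁻_n(c23; M) = (n−M)(n+c23+M+1)`. -/
def muM (n c23 M : ℝ) : ℝ := (n-M)*(n+c23+M+1)

/-- `B⁻(x; c1,c2; M)`. -/
def Bm (x c1 c2 M : ℝ) : ℝ := -(x-M)*(x-M+1)*Ffun x c1 c2

/-- `D⁻(x; c1,c2; M) = B⁻(−x−c12−1; c1,c2; M)`. -/
def Dm (x c1 c2 M : ℝ) : ℝ := Bm (-x-c1-c2-1) c1 c2 M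

/-- `S⁻ = B⁻ + D⁻ + M(c1+M)`. -/
def SmD (x c1 c2 M : ℝ) : ℝ := Bm x c1 c2 M + Dm x c1 c2 M + M*(c1+M)

/-- Nine-point recurrence coefficients `A^{e,e'}_{i,j}(c1,c2,c3,c4)` (with
`c0 = −2N−3−c1−c2−c3−c4`). -/
def nineA (e e' : ℤ) (i j : ℝ) (c1 c2 c3 c4 N : ℝ) : ℝ :=
  let c0 : ℝ := -2*N-3-c1-c2-c3-c4
  if e = 1 ∧ e' = 1 then -(Ffun (-j-c0-c4-1) c4 c0) * Cm i c1 c2 c3 (N-j+1)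
  else if e = 0 ∧ e' = 1 then (Ffun (-j-c0-c4-1) c4 c0) * Sm i c1 c2 c3 (N-j+1)
  else if e = -1 ∧ e' = 1 then -(Ffun (-j-c0-c4-1) c4 c0) * Am i c1 c2 c3 (N-j+1)
  else if e = 1 ∧ e' = -1 then -(Ffun j c4 c0) * Cp i c2 c3 (N-j-1)
  else if e = 0 ∧ e' = -1 then (Ffun j c4 c0) * Sp i c2 c3 (N-j-1)
  else if e = -1 ∧ e' = -1 then -(Ffun j c4 c0) * Ap i c2 c3 (N-j-1)
  else if e = 1 ∧ e' = 0 then (Ffun j c4 c0 + Ffun (-j-c0-c4-1) c4 c0) * coefC i c1 c2 c3 (N-j)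
  else if e = 0 ∧ e' = 0 then
    -(Ffun j c4 c0 + Ffun (-j-c0-c4-1) c4 c0) *
      (coefSig i c1 c2 c3 (N-j) + (N-j)^2 + (c1+c2+c3+2)*(N-j) + (1/2)*(c3+1)*(c1+c2+c3+1))
  else if e = -1 ∧ e' = 0 then (Ffun j c4 c0 + Ffun (-j-c0-c4-1) c4 c0) * coefA i c1 c2 c3 (N-j)
  else 0

/-- `Γ^{0,0}_{i,j}(c1,c2,c3,c4)`. -/
def gam00 (i j : ℝ) (c1 c2 c3 c4 N : ℝ) : ℝ :=
  let c0 : ℝ := -2*N-3-c1-c2-c3-c4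
  (-(coefSig i c1 c2 c3 (N-j)) + coefSig j c1 c0 c4 (N-i) - (1/4)*(c3^2-c4^2)
    + (i-N-(1/2)*(c4+1))*(i+(1/2)*(c2+c3-c0-c1))
    - (j-N-(1/2)*(c3+1))*(j+(1/2)*(c0+c4-c1-c2)))

/-- `Γ^{e,e'}_{i,j}` coefficients. -/
def gam (e e' : ℤ) (i j : ℝ) (c1 c2 c3 c4 N : ℝ) : ℝ :=
  let c0 : ℝ := -2*N-3-c1-c2-c3-c4
  if e = 0 ∧ e' = 1 then coefC j c1 c0 c4 (N-i)
  else if e = 0 ∧ e' = -1 then coefA j c1 c0 c4 (N-i)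
  else if e = 1 ∧ e' = 0 then coefC i c1 c2 c3 (N-j)
  else if e = -1 ∧ e' = 0 then coefA i c1 c2 c3 (N-j)
  else if e = 0 ∧ e' = 0 then gam00 i j c1 c2 c3 c4 N
  else 0

/-- Nine-point difference coefficients `D^{e,e'}(x,y; c1,c2,c3,c4)` (with
`c0 = −2N−3−c1−c2−c3−c4`). -/
def nineD (e e' : ℤ) (x y : ℝ) (c1 c2 c3 c4 N : ℝ) : ℝ :=
  let c0 : ℝ := -2*N-3-c1-c2-c3-c4
  if e = 1 ∧ e' = 1 then -(Ffun x c1 c2) * Bm y c3 c0 (N-x)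
  else if e = 1 ∧ e' = 0 then (Ffun x c1 c2) * SmD y c3 c0 (N-x)
  else if e = 1 ∧ e' = -1 then -(Ffun x c1 c2) * Dm y c3 c0 (N-x)
  else if e = -1 ∧ e' = 1 then -(Ffun (-x-c1-c2-1) c1 c2) * Bp y c3 c0 c4 (N-x)
  else if e = -1 ∧ e' = 0 then (Ffun (-x-c1-c2-1) c1 c2) * SpD y c3 c0 c4 (N-x)
  else if e = -1 ∧ e' = -1 then -(Ffun (-x-c1-c2-1) c1 c2) * Dp y c3 c0 c4 (N-x)
  else if e = 0 ∧ e' = 1 then (Ffun x c1 c2 + Ffun (-x-c1-c2-1) c1 c2) * coefB y c3 c0 c4 (N-x)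
  else if e = 0 ∧ e' = 0 then
    -(Ffun x c1 c2 + Ffun (-x-c1-c2-1) c1 c2) *
      (coefS y c3 c0 c4 (N-x) + (N-x)^2 + (c0+c3+c4+2)*(N-x) + (1/2)*(c3+1)*(c0+c3+c4+1))
  else if e = 0 ∧ e' = -1 then (Ffun x c1 c2 + Ffun (-x-c1-c2-1) c1 c2) * coefD y c3 c0 c4 (N-x)
  else 0

/-- `Ψ^{a,b}(x,y)` coefficients: the first superscript refers to the shift in `y`,
the second to the shift in `x` (with `c0 = −2N−3−c1−c2−c3−c4`). -/
def psi (a b : ℤ) (x y : ℝ) (c1 c2 c3 c4 N : ℝ) : ℝ :=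
  let c0 : ℝ := -2*N-3-c1-c2-c3-c4
  if a = 0 ∧ b = 1 then coefB x c4 c2 c1 (N-y)
  else if a = 0 ∧ b = -1 then coefD x c4 c2 c1 (N-y)
  else if a = 1 ∧ b = 0 then coefB y c3 c0 c1 (N-x)
  else if a = -1 ∧ b = 0 then coefD y c3 c0 c1 (N-x)
  else if a = 0 ∧ b = 0 then gam00 x y c1 c2 c4 c3 N
  else 0

/-- Tratnik polynomial of Racah type `T_{i,j}(x,y; c1,c2,c3,c4; N)`, set to `0` outside
the triangular domains. -/
def trat (c1 c2 c3 c4 : ℝ) (Nn : ℕ) (i j x y : ℤ) : ℝ :=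
  let c0 : ℝ := -2*(Nn:ℝ)-3-c1-c2-c3-c4
  if 0 ≤ i ∧ 0 ≤ j ∧ i + j ≤ (Nn:ℤ) ∧ 0 ≤ x ∧ 0 ≤ y ∧ x + y ≤ (Nn:ℤ) then
    racah i (x:ℝ) c1 c2 c3 ((Nn:ℤ)-j) * racah j (y:ℝ) c3 c0 c4 ((Nn:ℤ)-x)
  else 0

/-- Griffiths polynomial of Racah type `G_{i,j}(x,y; c1,c2,c3,c4; N)`, set to `0` outside
the triangular domains. -/
def grif (c1 c2 c3 c4 : ℝ) (Nn : ℕ) (i j x y : ℤ) : ℝ :=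
  let c0 : ℝ := -2*(Nn:ℝ)-3-c1-c2-c3-c4
  if 0 ≤ i ∧ 0 ≤ j ∧ i + j ≤ (Nn:ℤ) ∧ 0 ≤ x ∧ 0 ≤ y ∧ x + y ≤ (Nn:ℤ) then
    ∑ a ∈ Finset.range (((Nn:ℤ)-j).toNat + 1),
      (-1:ℝ)^a * racah i (a:ℝ) c1 c2 c3 ((Nn:ℤ)-j) * racah j (y:ℝ) c3 c0 c4 ((Nn:ℤ)-(a:ℤ)) *
        racah (a:ℤ) (x:ℝ) c4 c2 c1 ((Nn:ℤ)-y)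
  else 0

/-- Krawtchouk polynomial `K_n(x; p; M)`, set to `0` unless `0 ≤ n ≤ M`. -/
def kraw (n : ℤ) (x : ℝ) (p : ℝ) (M : ℤ) : ℝ :=
  if 0 ≤ n ∧ n ≤ M then
    (M.toNat.choose n.toNat : ℝ) * (p/(1-p))^n.toNat *
      ∑ k ∈ Finset.range (n.toNat + 1),
        poch (-(n:ℝ)) k * poch (-x) k / (poch (-(M:ℝ)) k * (Nat.factorial k : ℝ)) * (1/p)^k
  else 0

lemma poch_zero (a : ℝ) : poch a 0 = 1 := by simp [poch]

lemma poch_succ (a : ℝ) (k : ℕ) : poch a (k + 1) = poch a k * (a + k) := by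
  simp [poch, Finset.prod_range_succ]

lemma poch_succ' (a : ℝ) (k : ℕ) : poch a (k + 1) = a * poch (a + 1) k := by
  simp only [poch, Finset.prod_range_succ', Nat.cast_zero, add_zero]
  rw [mul_comm]
  congr 1
  refine Finset.prod_congr rfl fun i _ => ?_
  push_cast
  ring

/-- `a (a+1)_k = (a)_k (a+k)`. -/
lemma mul_poch_add_one (a : ℝ) (k : ℕ) : a * poch (a + 1) k = poch a k * (a + k) := by
  rw [← poch_succ', poch_succ]

lemma poch_ne_zero {a : ℝ} {k : ℕ} (h : ∀ i < k, a + i ≠ 0) : poch a k ≠ 0 :=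
  Finset.prod_ne_zero_iff.mpr fun i hi => h i (Finset.mem_range.mp hi)

lemma Generic.add_ne_zero {r : ℝ} (h : Generic r) (m : ℤ) : r + m ≠ 0 := fun e =>
  h (-m) (by push_cast; linarith)

lemma Generic.poch_ne_zero {r : ℝ} (h : Generic r) {a : ℝ} (m : ℤ) (ha : a = r + m) (k : ℕ) :
    poch a k ≠ 0 :=
  _root_.poch_ne_zero fun i _ => by
    have := h.add_ne_zero (m + i)
    push_cast at this
    rwa [ha, add_assoc]

/-- The basis function `(-x)_k (x+c+1)_k`, a polynomial of degree `k` in `x(x+c+1)`. -/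
def racahBasis (c x : ℝ) (k : ℕ) : ℝ := poch (-x) k * poch (x + c + 1) k

/-- The difference operator acts bidiagonally on the basis `racahBasis`. -/
lemma difference_racahBasis_succ {c1 c2 x : ℝ} (M : ℝ) (k : ℕ) (h0 : 2 * x + c1 + c2 ≠ 0)
    (h1 : 2 * x + c1 + c2 + 1 ≠ 0) (h2 : 2 * x + c1 + c2 + 2 ≠ 0) :
    Bm x c1 c2 M * racahBasis (c1 + c2) (x + 1) (k + 1)
        - SmD x c1 c2 M * racahBasis (c1 + c2) x (k + 1)
        + Dm x c1 c2 M * racahBasis (c1 + c2) (x - 1) (k + 1) =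
      (k + 1 - M) * (c1 + M - (k + 1)) * racahBasis (c1 + c2) x (k + 1)
        + (k + 1) * (k - M) * (k + 1 - M) * (k + 1 + c2) * racahBasis (c1 + c2) x k := by
  set P := poch (-x) k
  set Q := poch (x + (c1 + c2) + 1) k
  have e : racahBasis (c1 + c2) x k = P * Q := rfl
  have e0 : racahBasis (c1 + c2) x (k + 1) = P * (-x + k) * (Q * (x + (c1 + c2) + 1 + k)) := by
    rw [racahBasis, poch_succ, poch_succ]
  have eB : (x + c1 + c2 + 1) * racahBasis (c1 + c2) (x + 1) (k + 1) =
      (-x - 1) * P * (Q * (x + (c1 + c2) + 1 + k) * (x + (c1 + c2) + 2 + k)) := by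
    have hQ := mul_poch_add_one (x + (c1 + c2) + 1) k
    rw [racahBasis, poch_succ' (-(x + 1)), poch_succ (x + 1 + (c1 + c2) + 1),
      show -(x + 1) + 1 = -x by ring,
      show x + 1 + (c1 + c2) + 1 = x + (c1 + c2) + 1 + 1 by ring]
    linear_combination (-x - 1) * P * (x + (c1 + c2) + 2 + k) * hQ
  have eD : x * racahBasis (c1 + c2) (x - 1) (k + 1) =
      -(P * (-x + k) * (-x + 1 + k)) * ((x + (c1 + c2)) * Q) := by
    have hP := mul_poch_add_one (-x) k
    rw [racahBasis, poch_succ (-(x - 1)), poch_succ' (x - 1 + (c1 + c2) + 1),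
      show -(x - 1) = -x + 1 by ring,
      show x - 1 + (c1 + c2) + 1 = x + (c1 + c2) by ring]
    linear_combination -(-x + 1 + k) * (x + (c1 + c2)) * Q * hP
  have hF : Ffun (-x - c1 - c2 - 1) c1 c2 =
      x * (x + c1) / ((2 * x + c1 + c2 + 1) * (2 * x + c1 + c2)) := by
    rw [Ffun]
    congr 1 <;> ring
  have hB : Bm x c1 c2 M *
        (racahBasis (c1 + c2) (x + 1) (k + 1) - racahBasis (c1 + c2) x (k + 1)) =
      (k + 1) * (x - M) * (x - M + 1) * (x + c2 + 1) * (P * (Q * (x + (c1 + c2) + 1 + k))) /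
        (2 * x + c1 + c2 + 1) := by
    have hΔ : (x + c1 + c2 + 1) *
          (racahBasis (c1 + c2) (x + 1) (k + 1) - racahBasis (c1 + c2) x (k + 1)) =
        -(k + 1) * (2 * x + c1 + c2 + 2) * (P * (Q * (x + (c1 + c2) + 1 + k))) := by
      linear_combination eB - (x + c1 + c2 + 1) * e0
    rw [Bm, Ffun, mul_div_assoc', div_mul_eq_mul_div, div_eq_div_iff (mul_ne_zero h1 h2) h1]
    linear_combination -(x - M) * (x - M + 1) * (x + c2 + 1) * (2 * x + c1 + c2 + 1) * hΔ
  have hD : Dm x c1 c2 M *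
        (racahBasis (c1 + c2) (x - 1) (k + 1) - racahBasis (c1 + c2) x (k + 1)) =
      (k + 1) * (x + c1 + c2 + 1 + M) * (x + c1 + c2 + M) * (x + c1) * (P * (-x + k) * Q) /
        (2 * x + c1 + c2 + 1) := by
    have hΔ : x * (racahBasis (c1 + c2) (x - 1) (k + 1) - racahBasis (c1 + c2) x (k + 1)) =
        -(k + 1) * (2 * x + c1 + c2) * (P * (-x + k) * Q) := by
      linear_combination eD - x * e0
    rw [Dm, Bm, hF, mul_div_assoc', div_mul_eq_mul_div, div_eq_div_iff (mul_ne_zero h1 h0) h1]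
    linear_combination -(x + c1 + c2 + 1 + M) * (x + c1 + c2 + M) * (x + c1) *
      (2 * x + c1 + c2 + 1) * hΔ
  have core : (x - M) * (x - M + 1) * (x + c2 + 1) * (x + (c1 + c2) + 1 + k) +
        (x + c1 + c2 + 1 + M) * (x + c1 + c2 + M) * (x + c1) * (-x + k) =
      (2 * x + c1 + c2 + 1) * ((c1 + 2 * M - k - 1) * (-x + k) * (x + (c1 + c2) + 1 + k) +
        (k - M) * (k + 1 - M) * (k + 1 + c2)) := by
    ring
  have hBD : Bm x c1 c2 M *
          (racahBasis (c1 + c2) (x + 1) (k + 1) - racahBasis (c1 + c2) x (k + 1)) +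
        Dm x c1 c2 M *
          (racahBasis (c1 + c2) (x - 1) (k + 1) - racahBasis (c1 + c2) x (k + 1)) =
      (k + 1) * P * Q * ((c1 + 2 * M - k - 1) * (-x + k) * (x + (c1 + c2) + 1 + k) +
        (k - M) * (k + 1 - M) * (k + 1 + c2)) := by
    rw [hB, hD, ← add_div, div_eq_iff h1]
    linear_combination (k + 1) * P * Q * core
  rw [SmD, e]
  linear_combination hBD - (M * (c1 + M) + (k + 1 - M) * (c1 + M - (k + 1))) * e0

lemma difference_racahBasis_zero (c1 c2 x M : ℝ) :
    Bm x c1 c2 M * racahBasis (c1 + c2) (x + 1) 0 - SmD x c1 c2 M * racahBasis (c1 + c2) x 0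
        + Dm x c1 c2 M * racahBasis (c1 + c2) (x - 1) 0 =
      -M * (c1 + M) * racahBasis (c1 + c2) x 0 := by
  simp only [racahBasis, poch_zero, SmD]
  ring

/-- The coefficient of `racahBasis` in the Racah hypergeometric sum. -/
def racahCoeff (n : ℕ) (c1 c2 c3 M : ℝ) (k : ℕ) : ℝ :=
  poch (-(n : ℝ)) k * poch ((n : ℝ) + c2 + c3 + 1) k /
    (poch (c2 + 1) k * poch (M + 2 + c1 + c2 + c3) k * poch (-M) k * (Nat.factorial k : ℝ))

lemma racah_eq_sum (n M : ℕ) (h : n ≤ M) (x c1 c2 c3 : ℝ) :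
    racah n x c1 c2 c3 M = Om n c1 c2 c3 M *
      ∑ k ∈ Finset.range (n + 1), racahCoeff n c1 c2 c3 M k * racahBasis (c1 + c2) x k := by
  rw [racah, if_pos ⟨by positivity, by exact_mod_cast h⟩]
  congr 1
  refine Finset.sum_congr (by simp) fun k _ => ?_
  simp only [racahCoeff, racahBasis, Int.cast_natCast, ← add_assoc]
  ring

lemma racahCoeff_succ {n M k : ℕ} (hnM : n ≤ M) (hk : k < n) {c1 c2 c3 : ℝ}
    (h : Generic3 c1 c2 c3) :
    racahCoeff n c1 c2 c3 M (k + 1) * ((k + 1) * (k - M) * (k + 1 + c2)) =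
      racahCoeff n c1 c2 c3 M k * ((k - n) * (n + c2 + c3 + 1 + k) / (M + 2 + c1 + c2 + c3 + k)) := by
  obtain ⟨-, h2, -, -, -, -, h123⟩ := h
  have a1 : (k : ℝ) - M ≠ 0 := by
    have : (k : ℝ) < M := by exact_mod_cast hk.trans_le hnM
    linarith
  have a2 : c2 + 1 + k ≠ 0 := by
    have := h2.add_ne_zero (1 + k)
    push_cast at this
    rwa [add_assoc]
  have a3 : (M : ℝ) + 2 + c1 + c2 + c3 + k ≠ 0 := by
    have := h123.add_ne_zero (M + 2 + k)
    push_cast at this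
    convert this using 1
    ring
  have a4 : -(M : ℝ) + k ≠ 0 := by
    rwa [neg_add_eq_sub]
  have p1 : poch (c2 + 1) k ≠ 0 := h2.poch_ne_zero 1 (by simp) k
  have p2 : poch ((M : ℝ) + 2 + c1 + c2 + c3) k ≠ 0 :=
    h123.poch_ne_zero (M + 2) (by push_cast; ring) k
  have p3 : poch (-(M : ℝ)) k ≠ 0 := poch_ne_zero fun i hi => by
    have : (i : ℝ) < M := by exact_mod_cast (hi.trans hk).trans_le hnM
    linarith
  simp only [racahCoeff, poch_succ, Nat.factorial_succ]
  push_cast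
  have a5 : (k : ℝ) + 1 ≠ 0 := by positivity
  have a6 : (Nat.factorial k : ℝ) ≠ 0 := by positivity
  generalize poch (c2 + 1) k = p at *
  generalize poch ((M : ℝ) + 2 + c1 + c2 + c3) k = q at *
  generalize poch (-(M : ℝ)) k = r at *
  rw [div_mul_eq_mul_div, div_mul_div_comm, div_eq_div_iff (by positivity) (by positivity)]
  ring

/-- Raising the size parameter `M` by one in the coefficients. -/
lemma racahCoeff_add_one {n M k : ℕ} (hnM : n ≤ M) (hk : k ≤ n) {c1 c2 c3 : ℝ}
    (h : Generic3 c1 c2 c3) :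
    racahCoeff n c1 c2 c3 ((M : ℝ) + 1) k =
      racahCoeff n c1 c2 c3 M k * ((M + 2 + c1 + c2 + c3) * (M + 1 - k) /
        ((M + 2 + c1 + c2 + c3 + k) * (M + 1))) := by
  obtain ⟨-, h2, -, -, -, -, h123⟩ := h
  have a3 : (M : ℝ) + 2 + c1 + c2 + c3 + k ≠ 0 := by
    have := h123.add_ne_zero (M + 2 + k)
    push_cast at this
    convert this using 1
    ring
  have p2 : poch ((M : ℝ) + 2 + c1 + c2 + c3) k ≠ 0 :=
    h123.poch_ne_zero (M + 2) (by push_cast; ring) k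
  have p2' : poch ((M : ℝ) + 1 + 2 + c1 + c2 + c3) k ≠ 0 :=
    h123.poch_ne_zero (M + 3) (by push_cast; ring) k
  have hkM : (k : ℝ) ≤ M := by exact_mod_cast hk.trans hnM
  have p3 : poch (-(M : ℝ)) k ≠ 0 := poch_ne_zero fun i hi => by
    have : (i : ℝ) < k := by exact_mod_cast hi
    linarith
  have p3' : poch (-((M : ℝ) + 1)) k ≠ 0 := poch_ne_zero fun i hi => by
    have : (i : ℝ) < k := by exact_mod_cast hi
    linarith
  have p1 : poch (c2 + 1) k ≠ 0 := h2.poch_ne_zero 1 (by simp) k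
  have e2 := mul_poch_add_one ((M : ℝ) + 2 + c1 + c2 + c3) k
  have e3 := mul_poch_add_one (-((M : ℝ) + 1)) k
  rw [show (M : ℝ) + 2 + c1 + c2 + c3 + 1 = M + 1 + 2 + c1 + c2 + c3 by ring] at e2
  rw [show -((M : ℝ) + 1) + 1 = -M by ring] at e3
  have a6 : (Nat.factorial k : ℝ) ≠ 0 := by positivity
  have a7 : (M : ℝ) + 1 ≠ 0 := by positivity
  simp only [racahCoeff]
  rw [div_mul_div_comm, div_eq_div_iff (by positivity) (by positivity)]
  linear_combination (-1 : ℝ) * poch (-(n : ℝ)) k * poch ((n : ℝ) + c2 + c3 + 1) k *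
    poch (c2 + 1) k * (Nat.factorial k : ℝ) *
    (poch (-(M : ℝ)) k * (M + 1) * e2 +
      poch ((M : ℝ) + 1 + 2 + c1 + c2 + c3) k * (M + 2 + c1 + c2 + c3) * e3)

/-- Raising the size parameter `M` by one in the normalization. -/
lemma muM_mul_Om_add_one {n M : ℕ} (hnM : n ≤ M) {c1 c2 c3 : ℝ} (h : Generic3 c1 c2 c3) :
    muM n (c2 + c3) (M + 1) * Om n c1 c2 c3 ((M + 1 : ℕ) : ℤ) * (M + 2 + c1 + c2 + c3) =
      -(M + 1) * (M + 2 + c1 + c2 + c3 + n) * (c1 + M + 1 - n) * Om n c1 c2 c3 M := by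
  obtain ⟨-, -, h3, -, -, h23, -⟩ := h
  have t1 : (((M + 1 : ℕ) : ℤ) - (n : ℤ)).toNat = (M - n) + 1 := by omega
  have t2 : ((M : ℤ) - (n : ℤ)).toNat = M - n := by omega
  have hc : ((M + 1).choose n : ℝ) * (M + 1 - n) = (M + 1) * (M.choose n : ℝ) := by
    have := Nat.choose_mul_succ_eq M n
    have h' : ((M + 1 - n : ℕ) : ℝ) = M + 1 - n := by
      rw [Nat.cast_sub (by omega)]
      push_cast
      ring
    rw [← h', mul_comm ((M : ℝ) + 1)]
    exact_mod_cast this.symm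
  have e2 := mul_poch_add_one ((M : ℝ) + 2 + c1 + c2 + c3) n
  rw [show (M : ℝ) + 2 + c1 + c2 + c3 + 1 = M + 1 + 2 + c1 + c2 + c3 by ring] at e2
  have p3 : poch (c3 + 1) n ≠ 0 := h3.poch_ne_zero 1 (by simp) n
  have p23 : poch (c2 + c3 + n + 1) (M + 1) ≠ 0 :=
    h23.poch_ne_zero (n + 1) (by push_cast; ring) _
  have a : c2 + c3 + n + 1 + (M + 1) ≠ 0 := by
    have := h23.add_ne_zero (n + 1 + (M + 1))
    push_cast at this
    convert this using 1
    ring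
  simp only [Om, muM, t1, t2, Int.toNat_natCast, Int.cast_natCast]
  rw [poch_succ (c1 + 1), poch_succ (c2 + c3 + n + 1) (M + 1)]
  push_cast [Nat.cast_sub hnM]
  generalize poch (c2 + c3 + n + 1) (M + 1) = Z at *
  rw [mul_div_assoc', div_mul_eq_mul_div, mul_div_assoc', div_eq_div_iff (by positivity) (by positivity)]
  generalize poch (c3 + 1) n = Y at *
  generalize poch (c1 + 1) (M - n) = W
  generalize poch (c2 + 1) n = V
  generalize poch ((M : ℝ) + 1 + 2 + c1 + c2 + c3) n = U' at *
  generalize poch ((M : ℝ) + 2 + c1 + c2 + c3) n = U at *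
  generalize ((M + 1).choose n : ℝ) = C' at *
  generalize (M.choose n : ℝ) = C at *
  linear_combination (-1 : ℝ) * (n + (c2 + c3) + (M + 1) + 1) * (2 * n + c2 + c3 + 1) * V * W *
    (c1 + 1 + (M - n)) * Y * Z *
    ((M + 2 + c1 + c2 + c3) * U' * hc + (M + 1) * C * e2)

/-- The difference operator applied to the Racah sum of size `M` gives, up to a factor, the one
of size `M + 1`. -/
lemma difference_racah_sum {n M : ℕ} (hnM : n ≤ M) {c1 c2 c3 x : ℝ} (h : Generic3 c1 c2 c3)
    (h0 : 2 * x + c1 + c2 ≠ 0) (h1 : 2 * x + c1 + c2 + 1 ≠ 0) (h2 : 2 * x + c1 + c2 + 2 ≠ 0) :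
    (Bm x c1 c2 (M + 1) * ∑ k ∈ Finset.range (n + 1),
          racahCoeff n c1 c2 c3 M k * racahBasis (c1 + c2) (x + 1) k
        - SmD x c1 c2 (M + 1) * ∑ k ∈ Finset.range (n + 1),
          racahCoeff n c1 c2 c3 M k * racahBasis (c1 + c2) x k
        + Dm x c1 c2 (M + 1) * ∑ k ∈ Finset.range (n + 1),
          racahCoeff n c1 c2 c3 M k * racahBasis (c1 + c2) (x - 1) k) *
        (M + 2 + c1 + c2 + c3) =
      -(M + 1) * (M + 2 + c1 + c2 + c3 + n) * (c1 + M + 1 - n) *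
        ∑ k ∈ Finset.range (n + 1),
          racahCoeff n c1 c2 c3 ((M : ℝ) + 1) k * racahBasis (c1 + c2) x k := by
  set t := racahCoeff n c1 c2 c3 M
  set φ := racahBasis (c1 + c2) x
  have hs (k : ℕ) : (M : ℝ) + 2 + c1 + c2 + c3 + k ≠ 0 := by
    have := h.2.2.2.2.2.2.add_ne_zero (M + 2 + k)
    push_cast at this
    convert this using 1
    ring
  have hM : (M : ℝ) + 1 ≠ 0 := by positivity
  have key : Bm x c1 c2 (M + 1) * ∑ k ∈ Finset.range (n + 1),
          t k * racahBasis (c1 + c2) (x + 1) k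
        - SmD x c1 c2 (M + 1) * ∑ k ∈ Finset.range (n + 1), t k * φ k
        + Dm x c1 c2 (M + 1) * ∑ k ∈ Finset.range (n + 1),
          t k * racahBasis (c1 + c2) (x - 1) k =
      ∑ k ∈ Finset.range (n + 1), (k - (M + 1)) * (c1 + (M + 1) - k) * (t k * φ k) +
        ∑ k ∈ Finset.range n,
          t (k + 1) * ((k + 1) * (k - M) * (k + 1 + c2)) * ((k - (M + 1)) * φ k) := by
    rw [Finset.mul_sum, Finset.mul_sum, Finset.mul_sum, ← Finset.sum_sub_distrib,
      ← Finset.sum_add_distrib, Finset.sum_range_succ', Finset.sum_range_succ' _ n,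
      add_right_comm, ← Finset.sum_add_distrib]
    congr 1
    · refine Finset.sum_congr rfl fun k _ => ?_
      push_cast
      linear_combination t (k + 1) * difference_racahBasis_succ (M + 1 : ℝ) k h0 h1 h2
    · push_cast
      linear_combination t 0 * difference_racahBasis_zero c1 c2 x (M + 1)
  have shift : ∑ k ∈ Finset.range n,
        t (k + 1) * ((k + 1) * (k - M) * (k + 1 + c2)) * ((k - (M + 1)) * φ k) =
      ∑ k ∈ Finset.range (n + 1),
        t k * ((k - n) * (n + c2 + c3 + 1 + k) / (M + 2 + c1 + c2 + c3 + k)) *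
          ((k - (M + 1)) * φ k) := by
    rw [Finset.sum_range_succ, sub_self, zero_mul, zero_div, mul_zero, zero_mul, add_zero]
    refine Finset.sum_congr rfl fun k hk => ?_
    rw [racahCoeff_succ hnM (Finset.mem_range.mp hk) h]
  rw [key, shift, ← Finset.sum_add_distrib, Finset.mul_sum, Finset.sum_mul]
  refine Finset.sum_congr rfl fun k hk => ?_
  rw [racahCoeff_add_one hnM (Nat.lt_succ_iff.mp (Finset.mem_range.mp hk)) h]
  have := hs k
  rw [← mul_right_inj' (mul_ne_zero this hM)]
  rw [show racahCoeff n c1 c2 c3 M k = t k from rfl]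
  generalize t k = T
  generalize φ k = f
  have e1 : (k - n) * (n + c2 + c3 + 1 + k) / (M + 2 + c1 + c2 + c3 + k) *
      (M + 2 + c1 + c2 + c3 + k) = (k - n) * (n + c2 + c3 + 1 + k) := div_mul_cancel₀ _ this
  have e2 : (M + 2 + c1 + c2 + c3) * (M + 1 - k) / ((M + 2 + c1 + c2 + c3 + k) * (M + 1)) *
      ((M + 2 + c1 + c2 + c3 + k) * (M + 1)) = (M + 2 + c1 + c2 + c3) * (M + 1 - k) :=
    div_mul_cancel₀ _ (mul_ne_zero this hM)
  generalize (k - n) * (n + c2 + c3 + 1 + k) / (M + 2 + c1 + c2 + c3 + k) = R at *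
  generalize (M + 2 + c1 + c2 + c3) * (M + 1 - k) / ((M + 2 + c1 + c2 + c3 + k) * (M + 1)) = R' at *
  linear_combination (M + 1) * T * f * (k - (M + 1)) * (M + 2 + c1 + c2 + c3) * e1 +
    (M + 1) * (M + 2 + c1 + c2 + c3 + n) * (c1 + M + 1 - n) * T * f * e2

/-- contiguity difference equation (`N → N−1`) for the renormalized
Racah polynomials. -/
theorem racah_contiguity_difference_minus
    (c1 c2 c3 : ℝ) (hgen : Generic3 c1 c2 c3)
    (N n x : ℤ) (hN : 1 ≤ N) (hn0 : 0 ≤ n) (hnN : n ≤ N) (hx0 : 0 ≤ x) (hxN : x ≤ N) :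
    muM (n:ℝ) (c2+c3) (N:ℝ) * racah n (x:ℝ) c1 c2 c3 N =
      Bm (x:ℝ) c1 c2 (N:ℝ) * racah n ((x:ℝ)+1) c1 c2 c3 (N-1)
        - SmD (x:ℝ) c1 c2 (N:ℝ) * racah n (x:ℝ) c1 c2 c3 (N-1)
        + Dm (x:ℝ) c1 c2 (N:ℝ) * racah n ((x:ℝ)-1) c1 c2 c3 (N-1) := by
  obtain ⟨n, rfl⟩ := Int.eq_ofNat_of_zero_le hn0
  obtain ⟨M, rfl⟩ : ∃ M : ℕ, N = ((M + 1 : ℕ) : ℤ) := ⟨(N - 1).toNat, by omega⟩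
  rw [show (((M + 1 : ℕ) : ℤ) - 1) = (M : ℤ) by push_cast; ring]
  rcases (show n ≤ M ∨ n = M + 1 by omega) with hnM | rfl
  · have h12 : Generic (c1 + c2) := hgen.2.2.2.1
    have h0 : 2 * (x : ℝ) + c1 + c2 ≠ 0 := by
      have := h12.add_ne_zero (2 * x)
      push_cast at this
      convert this using 1
      ring
    have h1 : 2 * (x : ℝ) + c1 + c2 + 1 ≠ 0 := by
      have := h12.add_ne_zero (2 * x + 1)
      push_cast at this
      convert this using 1
      ring
    have h2 : 2 * (x : ℝ) + c1 + c2 + 2 ≠ 0 := by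
      have := h12.add_ne_zero (2 * x + 2)
      push_cast at this
      convert this using 1
      ring
    rw [racah_eq_sum n (M + 1) (by omega), racah_eq_sum n M hnM, racah_eq_sum n M hnM,
      racah_eq_sum n M hnM]
    push_cast
    have hsum := difference_racah_sum hnM hgen h0 h1 h2
    have hOm := muM_mul_Om_add_one hnM hgen
    push_cast at hOm
    have hs : (M : ℝ) + 2 + c1 + c2 + c3 ≠ 0 := by
      have := hgen.2.2.2.2.2.2.add_ne_zero (M + 2)
      push_cast at this
      convert this using 1
      ring
    refine mul_right_cancel₀ hs ?_
    linear_combination (∑ k ∈ Finset.range (n + 1), racahCoeff n c1 c2 c3 ((M : ℝ) + 1) k *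
      racahBasis (c1 + c2) x k) * hOm - Om n c1 c2 c3 M * hsum
  · have hr (y : ℝ) : racah ((M + 1 : ℕ) : ℤ) y c1 c2 c3 M = 0 :=
      if_neg fun h => by omega
    rw [hr, hr, hr, muM]
    simp
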